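/- arXiv:1608.00629 — 7 statements merged into one kernel-verified Lean document; each statement's English description precedes it below -/
import Mathlib

section
/- Suppose the weighting is weakly consistent, i.e., (Σ_{k=1}^{K(n)} w_{n,k}·|A_{n,k} ∇ A*(n)|)/r*(n) → 0 in probability as n → ∞. Then (Σ_{j ∈ A*(n)} S_{n,j})/r*(n) → 1 in probability as n → ∞. (Theorem 1(a), first claim.) -/
open MeasureTheory Filter

/-- The weighted average of the missed elements `B \ A k` is the cardinality of `B` minus the
total importance of the elements of `B`. -/
theorem card_sub_sum_importance {α κ : Type*} [DecidableEq α] [Fintype κ]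
    (w : κ → ℝ) (hw : ∑ k, w k = 1) (A : κ → Finset α) (B : Finset α) :
    (B.card : ℝ) - ∑ j ∈ B, ∑ k, w k * (if j ∈ A k then (1 : ℝ) else 0) =
      ∑ k, w k * ((B \ A k).card : ℝ) := by
  have hB : (B.card : ℝ) = ∑ k, w k * (B.card : ℝ) := by rw [← Finset.sum_mul, hw, one_mul]
  rw [Finset.sum_comm, hB, ← Finset.sum_sub_distrib]
  refine Finset.sum_congr rfl fun k _ => ?_
  rw [← Finset.mul_sum, ← mul_sub, Finset.sum_boole, Finset.filter_mem_eq_inter]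
  have h : ((B \ A k).card : ℝ) + (B ∩ A k).card = B.card :=
    mod_cast Finset.card_sdiff_add_card_inter B (A k)
  rw [← h, add_sub_cancel_right]

/-- The normalised total importance of `B` deviates from `1` by at most the normalised weighted
symmetric difference. -/
theorem abs_sum_importance_div_card_sub_one_le {α κ : Type*} [DecidableEq α] [Fintype κ]
    (w : κ → ℝ) (hw0 : ∀ k, 0 ≤ w k) (hw : ∑ k, w k = 1) (A : κ → Finset α) (B : Finset α)
    (hB : 0 < B.card) :
    |(∑ j ∈ B, ∑ k, w k * (if j ∈ A k then (1 : ℝ) else 0)) / (B.card : ℝ) - 1| ≤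
      |(∑ k, w k * ((symmDiff (A k) B).card : ℝ)) / (B.card : ℝ)| := by
  have hB' : (0 : ℝ) < B.card := mod_cast hB
  rw [div_sub_one hB'.ne', abs_div, abs_div, abs_sub_comm, card_sub_sum_importance w hw]
  gcongr
  · exact Finset.sum_nonneg fun k _ => mul_nonneg (hw0 k) (Nat.cast_nonneg _)
  · exact hw0 _
  · exact le_sup_right

/-- Theorem 1(a), first claim: under weakly consistent weighting,
`(∑_{j ∈ A*} S_j) / r* → 1` in probability. -/
theorem soil_thm1a_true_importance
    (p K r : ℕ → ℕ) (hp : ∀ n, 0 < p n) (hK : ∀ n, 0 < K n) (hr : ∀ n, 0 < r n)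
    (Ω : ℕ → Type*) [∀ n, MeasurableSpace (Ω n)]
    (μ : ∀ n, Measure (Ω n)) [∀ n, IsProbabilityMeasure (μ n)]
    (Astar : ∀ n, Finset (Fin (p n))) (hAcard : ∀ n, (Astar n).card = r n)
    (A : ∀ n, Fin (K n) → Ω n → Finset (Fin (p n)))
    (w : ∀ n, Fin (K n) → Ω n → ℝ)
    (hw0 : ∀ n k ω, 0 ≤ w n k ω)
    (hw1 : ∀ n ω, ∑ k, w n k ω = 1)
    (S : ∀ n, Fin (p n) → Ω n → ℝ)
    (hS : ∀ n j ω, S n j ω = ∑ k, w n k ω * (if j ∈ A n k ω then (1 : ℝ) else 0))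
    (hweak : ∀ ε > (0 : ℝ), Tendsto
      (fun n => μ n {ω | ε ≤
        |(∑ k, w n k ω * ((symmDiff (A n k ω) (Astar n)).card : ℝ)) / (r n : ℝ)|})
      atTop (nhds 0)) :
    ∀ ε > (0 : ℝ), Tendsto
      (fun n => μ n {ω | ε ≤ |(∑ j ∈ Astar n, S n j ω) / (r n : ℝ) - 1|})
      atTop (nhds 0) := by
  intro ε hε
  refine tendsto_of_tendsto_of_tendsto_of_le_of_le tendsto_const_nhds (hweak ε hε)
    (fun _ => zero_le) fun n =>
      measure_mono (Set.ofPred_subset_ofPred.2 fun ω hω => hω.trans ?_)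
  simp only [hS, ← hAcard]
  exact abs_sum_importance_div_card_sub_one_le (fun k => w n k ω) (hw0 n · ω) (hw1 n ω)
    (fun k => A n k ω) (Astar n) (hAcard n ▸ hr n)
end

section
/- Suppose the weighting is weakly consistent, i.e., (Σ_{k=1}^{K(n)} w_{n,k}·|A_{n,k} ∇ A*(n)|)/r*(n) → 0 in probability as n → ∞. Then (Σ_{j ∉ A*(n)} S_{n,j})/r*(n) → 0 in probability as n → ∞, where the sum ranges over j ∈ {1,…,p(n)} with j ∉ A*(n). (Theorem 1(a), second claim.) -/
open MeasureTheory Filter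

/-- The total weight placed on elements outside `B` is at most the weighted size of the symmetric
differences with `B`. -/
lemma sum_compl_weighted_indicator_le {ι α : Type*} [Fintype ι] [Fintype α] [DecidableEq α]
    (w : ι → ℝ) (hw : ∀ k, 0 ≤ w k) (A : ι → Finset α) (B : Finset α) :
    ∑ j ∈ Bᶜ, ∑ k, w k * (if j ∈ A k then (1 : ℝ) else 0) ≤
      ∑ k, w k * ((symmDiff (A k) B).card : ℝ) := by
  rw [Finset.sum_comm]
  refine Finset.sum_le_sum fun k _ => ?_
  rw [← Finset.mul_sum, Finset.sum_boole]
  refine mul_le_mul_of_nonneg_left ?_ (hw k)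
  refine Nat.cast_le.mpr (Finset.card_le_card fun j hj => ?_)
  simp only [Finset.mem_filter, Finset.mem_compl] at hj
  exact Finset.mem_symmDiff.mpr (Or.inl ⟨hj.2, hj.1⟩)

/-- Theorem 1(a), second claim: under weakly consistent weighting,
`(∑_{j ∉ A*} S_j) / r* → 0` in probability. -/
theorem soil_thm1a_noise_importance
    (p K r : ℕ → ℕ) (hp : ∀ n, 0 < p n) (hK : ∀ n, 0 < K n) (hr : ∀ n, 0 < r n)
    (Ω : ℕ → Type*) [∀ n, MeasurableSpace (Ω n)]
    (μ : ∀ n, Measure (Ω n)) [∀ n, IsProbabilityMeasure (μ n)]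
    (Astar : ∀ n, Finset (Fin (p n))) (hAcard : ∀ n, (Astar n).card = r n)
    (A : ∀ n, Fin (K n) → Ω n → Finset (Fin (p n)))
    (w : ∀ n, Fin (K n) → Ω n → ℝ)
    (hw0 : ∀ n k ω, 0 ≤ w n k ω)
    (hw1 : ∀ n ω, ∑ k, w n k ω = 1)
    (S : ∀ n, Fin (p n) → Ω n → ℝ)
    (hS : ∀ n j ω, S n j ω = ∑ k, w n k ω * (if j ∈ A n k ω then (1 : ℝ) else 0))
    (hweak : ∀ ε > (0 : ℝ), Tendsto
      (fun n => μ n {ω | ε ≤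
        |(∑ k, w n k ω * ((symmDiff (A n k ω) (Astar n)).card : ℝ)) / (r n : ℝ)|})
      atTop (nhds 0)) :
    ∀ ε > (0 : ℝ), Tendsto
      (fun n => μ n {ω | ε ≤ |(∑ j ∈ (Astar n)ᶜ, S n j ω) / (r n : ℝ)|})
      atTop (nhds 0) := by
  intro ε hε
  refine tendsto_of_tendsto_of_tendsto_of_le_of_le tendsto_const_nhds (hweak ε hε)
    (fun n => zero_le) fun n => measure_mono fun ω hω => ?_
  refine le_trans (Set.mem_ofPred_eq ▸ hω) (abs_le_abs_of_nonneg ?_ ?_)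
  · simp only [hS]
    exact div_nonneg (Finset.sum_nonneg fun j _ => Finset.sum_nonneg fun k _ =>
      mul_nonneg (hw0 n k ω) (by positivity)) (Nat.cast_nonneg _)
  · simp only [hS]
    gcongr
    exact sum_compl_weighted_indicator_le _ (fun k => hw0 n k ω) _ _
end

section
/- Suppose the weighting is consistent, i.e., Σ_{k=1}^{K(n)} w_{n,k}·|A_{n,k} ∇ A*(n)| → 0 in probability as n → ∞, and that A*(n) is nonempty for each n. Then min_{j ∈ A*(n)} S_{n,j} → 1 in probability as n → ∞. (Theorem 1(b), first claim.) -/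
open MeasureTheory Filter

/-- The weighted frequency with which the sets `A k` contain `j ∈ B` differs from one by at most
the weighted mean of the cardinalities of `A k ∆ B`. -/
theorem abs_sum_weight_mem_sub_one_le {ι α : Type*} [Fintype ι] [DecidableEq α]
    {w : ι → ℝ} (hw0 : ∀ k, 0 ≤ w k) (hw1 : ∑ k, w k = 1) (A : ι → Finset α)
    {B : Finset α} {j : α} (hj : j ∈ B) :
    |∑ k, w k * (if j ∈ A k then (1 : ℝ) else 0) - 1| ≤
      ∑ k, w k * ((symmDiff (A k) B).card : ℝ) := by
  conv_lhs => enter [1, 2]; rw [← hw1]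
  rw [← Finset.sum_sub_distrib]
  refine (Finset.abs_sum_le_sum_abs _ _).trans (Finset.sum_le_sum fun k _ => ?_)
  split_ifs with h
  · simpa using mul_nonneg (hw0 k) (Nat.cast_nonneg _)
  · have hpos : 1 ≤ (symmDiff (A k) B).card :=
      Finset.card_pos.mpr ⟨j, Finset.mem_symmDiff.mpr (Or.inr ⟨hj, h⟩)⟩
    have hcard : (1 : ℝ) ≤ ((symmDiff (A k) B).card : ℝ) := by exact_mod_cast hpos
    simpa [abs_of_nonneg (hw0 k)] using mul_le_mul_of_nonneg_left hcard (hw0 k)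

/-- Theorem 1(b), first claim: under consistent weighting,
`min_{j ∈ A*} S_j → 1` in probability. -/
theorem soil_thm1b_min_true_importance
    (p K r : ℕ → ℕ) (hp : ∀ n, 0 < p n) (hK : ∀ n, 0 < K n) (hr : ∀ n, 0 < r n)
    (Ω : ℕ → Type*) [∀ n, MeasurableSpace (Ω n)]
    (μ : ∀ n, Measure (Ω n)) [∀ n, IsProbabilityMeasure (μ n)]
    (Astar : ∀ n, Finset (Fin (p n))) (hAcard : ∀ n, (Astar n).card = r n)
    (hne : ∀ n, (Astar n).Nonempty)
    (A : ∀ n, Fin (K n) → Ω n → Finset (Fin (p n)))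
    (w : ∀ n, Fin (K n) → Ω n → ℝ)
    (hw0 : ∀ n k ω, 0 ≤ w n k ω)
    (hw1 : ∀ n ω, ∑ k, w n k ω = 1)
    (S : ∀ n, Fin (p n) → Ω n → ℝ)
    (hS : ∀ n j ω, S n j ω = ∑ k, w n k ω * (if j ∈ A n k ω then (1 : ℝ) else 0))
    (hcons : ∀ ε > (0 : ℝ), Tendsto
      (fun n => μ n {ω | ε ≤
        |∑ k, w n k ω * ((symmDiff (A n k ω) (Astar n)).card : ℝ)|})
      atTop (nhds 0)) :
    ∀ ε > (0 : ℝ), Tendsto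
      (fun n => μ n {ω | ε ≤ |(Astar n).inf' (hne n) (fun j => S n j ω) - 1|})
      atTop (nhds 0) := by
  intro ε hε
  refine tendsto_of_tendsto_of_tendsto_of_le_of_le tendsto_const_nhds (hcons ε hε)
    (fun n => zero_le) fun n => measure_mono fun ω hω => ?_
  obtain ⟨j, hj, hmin⟩ := (Astar n).exists_mem_eq_inf' (hne n) fun j => S n j ω
  rw [Set.mem_ofPred_eq, hmin, hS] at hω
  exact (hω.trans (abs_sum_weight_mem_sub_one_le (hw0 n · ω) (hw1 n ω) (A n · ω) hj)).trans
    (le_abs_self _)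
end

section
/- Suppose the weighting is consistent, i.e., Σ_{k=1}^{K(n)} w_{n,k}·|A_{n,k} ∇ A*(n)| → 0 in probability as n → ∞, and that for each n the complement {1,…,p(n)} \ A*(n) is nonempty. Then max_{j ∉ A*(n)} S_{n,j} → 0 in probability as n → ∞, where the maximum is over j ∈ {1,…,p(n)} with j ∉ A*(n). (Theorem 1(b), second claim.) -/
open MeasureTheory Filter

/-- A weighted inclusion frequency of an element outside `T` is at most the weighted mean
size of the symmetric differences with `T`. -/
lemma sum_weight_mem_le_sum_weight_card_symmDiff {ι α : Type*} [Fintype ι] [DecidableEq α]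
    {w : ι → ℝ} (hw : ∀ k, 0 ≤ w k) (A : ι → Finset α) {T : Finset α} {j : α} (hj : j ∉ T) :
    ∑ k, w k * (if j ∈ A k then (1 : ℝ) else 0) ≤
      ∑ k, w k * ((symmDiff (A k) T).card : ℝ) := by
  refine Finset.sum_le_sum fun k _ => mul_le_mul_of_nonneg_left ?_ (hw k)
  split_ifs with h
  · exact_mod_cast Finset.card_pos.2 ⟨j, Finset.mem_symmDiff.2 (Or.inl ⟨h, hj⟩)⟩
  · positivity

/-- Theorem 1(b), second claim: under consistent weighting,
`max_{j ∉ A*} S_j → 0` in probability. -/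
theorem soil_thm1b_max_noise_importance
    (p K r : ℕ → ℕ) (hp : ∀ n, 0 < p n) (hK : ∀ n, 0 < K n) (hr : ∀ n, 0 < r n)
    (Ω : ℕ → Type*) [∀ n, MeasurableSpace (Ω n)]
    (μ : ∀ n, Measure (Ω n)) [∀ n, IsProbabilityMeasure (μ n)]
    (Astar : ∀ n, Finset (Fin (p n))) (hAcard : ∀ n, (Astar n).card = r n)
    (hne : ∀ n, ((Astar n)ᶜ : Finset (Fin (p n))).Nonempty)
    (A : ∀ n, Fin (K n) → Ω n → Finset (Fin (p n)))
    (w : ∀ n, Fin (K n) → Ω n → ℝ)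
    (hw0 : ∀ n k ω, 0 ≤ w n k ω)
    (hw1 : ∀ n ω, ∑ k, w n k ω = 1)
    (S : ∀ n, Fin (p n) → Ω n → ℝ)
    (hS : ∀ n j ω, S n j ω = ∑ k, w n k ω * (if j ∈ A n k ω then (1 : ℝ) else 0))
    (hcons : ∀ ε > (0 : ℝ), Tendsto
      (fun n => μ n {ω | ε ≤
        |∑ k, w n k ω * ((symmDiff (A n k ω) (Astar n)).card : ℝ)|})
      atTop (nhds 0)) :
    ∀ ε > (0 : ℝ), Tendsto
      (fun n => μ n {ω | ε ≤ |((Astar n)ᶜ).sup' (hne n) (fun j => S n j ω) - 0|})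
      atTop (nhds 0) := by
  intro ε hε
  refine tendsto_of_tendsto_of_tendsto_of_le_of_le tendsto_const_nhds (hcons ε hε)
    (fun _ => zero_le) fun n => measure_mono fun ω hω => ?_
  rw [Set.mem_ofPred_eq, sub_zero] at hω
  refine hω.trans ?_
  have hnonneg : 0 ≤ ((Astar n)ᶜ).sup' (hne n) (fun j => S n j ω) := by
    obtain ⟨j, hj⟩ := hne n
    refine le_trans ?_ (Finset.le_sup' (fun j => S n j ω) hj)
    rw [hS]
    exact Finset.sum_nonneg fun k _ => mul_nonneg (hw0 n k ω) (by split_ifs <;> norm_num)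
  rw [abs_of_nonneg hnonneg]
  refine le_trans (Finset.sup'_le _ _ fun j hj => ?_) (le_abs_self _)
  rw [hS]
  exact sum_weight_mem_le_sum_weight_card_symmDiff (fun k => hw0 n k ω) (fun k => A n k ω)
    (Finset.mem_compl.1 hj)
end

section
/- Fix a threshold c ∈ (0,1) and define the missed-variable set Ā_c(n)(ω) = {j ∈ A*(n) : S_{n,j}(ω) ≤ c}. If the weighting is weakly consistent, i.e., (Σ_{k=1}^{K(n)} w_{n,k}·|A_{n,k} ∇ A*(n)|)/r*(n) → 0 in probability, then |Ā_c(n)|/r*(n) → 0 in probability as n → ∞. (Theorem 2, first claim.) -/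
open MeasureTheory Filter

/-- If every element of `F ⊆ B` has importance at most `c`, then the weighted symmetric difference
between the candidate models and `B` is at least `(1 - c) * |F|`. -/
theorem one_sub_mul_card_le_sum_mul_card_symmDiff {α κ : Type*} [DecidableEq α] [Fintype κ]
    {w : κ → ℝ} (hw0 : ∀ k, 0 ≤ w k) (hw1 : ∑ k, w k = 1) (A : κ → Finset α)
    {B F : Finset α} (hFB : F ⊆ B) {c : ℝ}
    (hF : ∀ j ∈ F, ∑ k, w k * (if j ∈ A k then (1 : ℝ) else 0) ≤ c) :
    (1 - c) * (F.card : ℝ) ≤ ∑ k, w k * ((symmDiff (A k) B).card : ℝ) := by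
  calc (1 - c) * (F.card : ℝ) = ∑ _j ∈ F, (1 - c) := by
        rw [Finset.sum_const, nsmul_eq_mul, mul_comm]
    _ ≤ ∑ j ∈ F, ∑ k, w k * (if j ∈ A k then (0 : ℝ) else 1) := by
        refine Finset.sum_le_sum fun j hj => ?_
        have hsum : ∑ k, w k * (if j ∈ A k then (0 : ℝ) else 1)
            + ∑ k, w k * (if j ∈ A k then (1 : ℝ) else 0) = 1 := by
          rw [← Finset.sum_add_distrib]
          refine Eq.trans ?_ hw1
          refine Finset.sum_congr rfl fun k _ => ?_
          split_ifs <;> ring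
        linarith [hF j hj]
    _ = ∑ k, w k * ((F \ A k).card : ℝ) := by
        rw [Finset.sum_comm]
        refine Finset.sum_congr rfl fun k _ => ?_
        rw [← Finset.mul_sum, Finset.card_eq_sum_ones, ← Finset.filter_notMem_eq_sdiff,
          Finset.sum_filter]
        push_cast
        simp only [ite_not]
    _ ≤ ∑ k, w k * ((symmDiff (A k) B).card : ℝ) := by
        refine Finset.sum_le_sum fun k _ => mul_le_mul_of_nonneg_left ?_ (hw0 k)
        refine Nat.cast_le.mpr (Finset.card_le_card fun j hj => ?_)
        rw [Finset.mem_sdiff] at hj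
        exact Finset.mem_symmDiff.mpr (Or.inr ⟨hFB hj.1, hj.2⟩)

/-- Theorem 2, first claim: for any threshold `c ∈ (0,1)`, under weakly consistent
weighting, `|{j ∈ A* : S_j ≤ c}| / r* → 0` in probability. -/
theorem soil_thm2_missed_variables
    (p K r : ℕ → ℕ) (hp : ∀ n, 0 < p n) (hK : ∀ n, 0 < K n) (hr : ∀ n, 0 < r n)
    (Ω : ℕ → Type*) [∀ n, MeasurableSpace (Ω n)]
    (μ : ∀ n, Measure (Ω n)) [∀ n, IsProbabilityMeasure (μ n)]
    (Astar : ∀ n, Finset (Fin (p n))) (hAcard : ∀ n, (Astar n).card = r n)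
    (A : ∀ n, Fin (K n) → Ω n → Finset (Fin (p n)))
    (w : ∀ n, Fin (K n) → Ω n → ℝ)
    (hw0 : ∀ n k ω, 0 ≤ w n k ω)
    (hw1 : ∀ n ω, ∑ k, w n k ω = 1)
    (S : ∀ n, Fin (p n) → Ω n → ℝ)
    (hS : ∀ n j ω, S n j ω = ∑ k, w n k ω * (if j ∈ A n k ω then (1 : ℝ) else 0))
    (c : ℝ) (hc : c ∈ Set.Ioo (0 : ℝ) 1)
    (hweak : ∀ ε > (0 : ℝ), Tendsto
      (fun n => μ n {ω | ε ≤
        |(∑ k, w n k ω * ((symmDiff (A n k ω) (Astar n)).card : ℝ)) / (r n : ℝ)|})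
      atTop (nhds 0)) :
    ∀ ε > (0 : ℝ), Tendsto
      (fun n => μ n {ω | ε ≤
        |(((Astar n).filter (fun j => S n j ω ≤ c)).card : ℝ) / (r n : ℝ)|})
      atTop (nhds 0) := by
  intro ε hε
  have hc' : 0 < 1 - c := sub_pos.mpr hc.2
  refine tendsto_of_tendsto_of_tendsto_of_le_of_le tendsto_const_nhds
    (hweak ((1 - c) * ε) (mul_pos hc' hε)) (fun n => zero_le) fun n => measure_mono fun ω hω => ?_
  rw [Set.mem_ofPred_eq, abs_of_nonneg (by positivity)] at hω
  have hcard := one_sub_mul_card_le_sum_mul_card_symmDiff (fun k => hw0 n k ω) (hw1 n ω)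
    (fun k => A n k ω) (Finset.filter_subset (fun j => S n j ω ≤ c) (Astar n)) (c := c)
    fun j hj => (hS n j ω).ge.trans (Finset.mem_filter.mp hj).2
  calc (1 - c) * ε
      ≤ (1 - c) * ((((Astar n).filter (fun j => S n j ω ≤ c)).card : ℝ) / (r n : ℝ)) := by gcongr
    _ = (1 - c) * (((Astar n).filter (fun j => S n j ω ≤ c)).card : ℝ) / (r n : ℝ) :=
        (mul_div_assoc _ _ _).symm
    _ ≤ (∑ k, w n k ω * ((symmDiff (A n k ω) (Astar n)).card : ℝ)) / (r n : ℝ) := by gcongr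
    _ ≤ _ := le_abs_self _
end

section
/- Fix a threshold c ∈ (0,1) and define the over-selected set 𝔄_c(n)(ω) = {j ∈ {1,…,p(n)} : j ∉ A*(n) and S_{n,j}(ω) > c}. If the weighting is weakly consistent, i.e., (Σ_{k=1}^{K(n)} w_{n,k}·|A_{n,k} ∇ A*(n)|)/r*(n) → 0 in probability, then |𝔄_c(n)|/r*(n) → 0 in probability as n → ∞. (Theorem 2, second claim.) -/
open MeasureTheory Filter

/-- If every element of `O` lies outside `B` and has total weight at least `c` among the sets
`A k`, then `c * #O` is at most the weighted sum of the cardinalities of `A k ∆ B`. -/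
theorem mul_card_le_sum_mul_card_symmDiff {ι α : Type*} [Fintype ι] [DecidableEq α]
    (B : Finset α) (A : ι → Finset α) (w : ι → ℝ) (hw : ∀ k, 0 ≤ w k)
    (O : Finset α) (c : ℝ) (hOB : ∀ j ∈ O, j ∉ B)
    (hO : ∀ j ∈ O, c ≤ ∑ k, w k * (if j ∈ A k then (1 : ℝ) else 0)) :
    c * (O.card : ℝ) ≤ ∑ k, w k * ((symmDiff (A k) B).card : ℝ) := by
  calc c * (O.card : ℝ) = ∑ _j ∈ O, c := by rw [Finset.sum_const, nsmul_eq_mul, mul_comm]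
    _ ≤ ∑ j ∈ O, ∑ k, w k * (if j ∈ A k then (1 : ℝ) else 0) := Finset.sum_le_sum hO
    _ = ∑ k, w k * ((O.filter (· ∈ A k)).card : ℝ) := by
      rw [Finset.sum_comm]
      simp_rw [← Finset.mul_sum, Finset.sum_boole]
    _ ≤ ∑ k, w k * ((symmDiff (A k) B).card : ℝ) := by
      refine Finset.sum_le_sum fun k _ => mul_le_mul_of_nonneg_left ?_ (hw k)
      refine Nat.cast_le.mpr (Finset.card_le_card fun j hj => ?_)
      rw [Finset.mem_filter] at hj
      exact Finset.mem_symmDiff.mpr (Or.inl ⟨hj.2, hOB j hj.1⟩)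

/-- Theorem 2, second claim: for any threshold `c ∈ (0,1)`, under weakly consistent
weighting, `|{j ∉ A* : S_j > c}| / r* → 0` in probability. -/
theorem soil_thm2_overselected_variables
    (p K r : ℕ → ℕ) (hp : ∀ n, 0 < p n) (hK : ∀ n, 0 < K n) (hr : ∀ n, 0 < r n)
    (Ω : ℕ → Type*) [∀ n, MeasurableSpace (Ω n)]
    (μ : ∀ n, Measure (Ω n)) [∀ n, IsProbabilityMeasure (μ n)]
    (Astar : ∀ n, Finset (Fin (p n))) (hAcard : ∀ n, (Astar n).card = r n)
    (A : ∀ n, Fin (K n) → Ω n → Finset (Fin (p n)))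
    (w : ∀ n, Fin (K n) → Ω n → ℝ)
    (hw0 : ∀ n k ω, 0 ≤ w n k ω)
    (hw1 : ∀ n ω, ∑ k, w n k ω = 1)
    (S : ∀ n, Fin (p n) → Ω n → ℝ)
    (hS : ∀ n j ω, S n j ω = ∑ k, w n k ω * (if j ∈ A n k ω then (1 : ℝ) else 0))
    (c : ℝ) (hc : c ∈ Set.Ioo (0 : ℝ) 1)
    (hweak : ∀ ε > (0 : ℝ), Tendsto
      (fun n => μ n {ω | ε ≤
        |(∑ k, w n k ω * ((symmDiff (A n k ω) (Astar n)).card : ℝ)) / (r n : ℝ)|})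
      atTop (nhds 0)) :
    ∀ ε > (0 : ℝ), Tendsto
      (fun n => μ n {ω | ε ≤
        |((Finset.univ.filter (fun j => j ∉ Astar n ∧ c < S n j ω)).card : ℝ) / (r n : ℝ)|})
      atTop (nhds 0) := by
  intro ε hε
  refine tendsto_of_tendsto_of_tendsto_of_le_of_le tendsto_const_nhds
    (hweak (c * ε) (mul_pos hc.1 hε)) (fun _ => zero_le) fun n => measure_mono fun ω hω => ?_
  have hr' : (0 : ℝ) < r n := Nat.cast_pos.mpr (hr n)
  have hcard := mul_card_le_sum_mul_card_symmDiff (Astar n) (fun k => A n k ω)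
    (fun k => w n k ω) (fun k => hw0 n k ω)
    (Finset.univ.filter fun j => j ∉ Astar n ∧ c < S n j ω) c
    (fun j hj => (Finset.mem_filter.mp hj).2.1)
    (fun j hj => hS n j ω ▸ (Finset.mem_filter.mp hj).2.2.le)
  rw [Set.mem_ofPred_eq, abs_of_nonneg (by positivity)] at hω
  rw [Set.mem_ofPred_eq]
  refine le_trans ?_ (le_abs_self _)
  calc c * ε ≤ c * (_ / (r n : ℝ)) := mul_le_mul_of_nonneg_left hω hc.1.le
    _ = c * _ / (r n : ℝ) := (mul_div_assoc _ _ _).symm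
    _ ≤ _ := div_le_div_of_nonneg_right hcard hr'.le
end

section
/- Fix a threshold c ∈ (0,1) and define the thresholded model A_c(n)(ω) = {j ∈ {1,…,p(n)} : S_{n,j}(ω) > c}. If the weighting is weakly consistent, i.e., (Σ_{k=1}^{K(n)} w_{n,k}·|A_{n,k} ∇ A*(n)|)/r*(n) → 0 in probability, then |A_c(n) ∇ A*(n)|/r*(n) → 0 in probability as n → ∞. (Remark following Theorem 2.) -/
open MeasureTheory Filter

/-- The weighted number of errors of the candidate models dominates, up to the factor
`min c (1 - c)`, the number of errors of the model thresholded at `c`. -/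
theorem min_mul_card_symmDiff_filter_le {ι κ : Type*} [Fintype ι] [DecidableEq ι] [Fintype κ]
    (w : κ → ℝ) (hw0 : ∀ k, 0 ≤ w k) (hw1 : ∑ k, w k = 1) (A : κ → Finset ι) (B : Finset ι)
    (S : ι → ℝ) (hS : ∀ j, S j = ∑ k, w k * (if j ∈ A k then (1 : ℝ) else 0)) (c : ℝ) :
    min c (1 - c) * ((symmDiff (Finset.univ.filter (fun j => c < S j)) B).card : ℝ) ≤
      ∑ k, w k * ((symmDiff (A k) B).card : ℝ) := by
  have hd0 (j : ι) : 0 ≤ ∑ k, w k * (if j ∈ symmDiff (A k) B then (1 : ℝ) else 0) :=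
    Finset.sum_nonneg fun k _ => mul_nonneg (hw0 k) (by split_ifs <;> norm_num)
  have hsum : ∑ k, w k * ((symmDiff (A k) B).card : ℝ) =
      ∑ j, ∑ k, w k * (if j ∈ symmDiff (A k) B then (1 : ℝ) else 0) := by
    rw [Finset.sum_comm]
    refine Finset.sum_congr rfl fun k _ => ?_
    rw [← Finset.mul_sum, Finset.sum_boole, Finset.filter_univ_mem]
  rw [hsum, mul_comm, ← nsmul_eq_mul]
  refine (Finset.card_nsmul_le_sum _ _ _ fun j hj => ?_).trans
    (Finset.sum_le_sum_of_subset_of_nonneg (Finset.subset_univ _) fun j _ _ => hd0 j)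
  rw [Finset.mem_symmDiff, Finset.mem_filter_univ] at hj
  rcases hj with ⟨hcS, hB⟩ | ⟨hB, hcS⟩
  · have h : ∑ k, w k * (if j ∈ symmDiff (A k) B then (1 : ℝ) else 0) = S j := by
      simp [hS, Finset.mem_symmDiff, hB]
    exact h ▸ (min_le_left _ _).trans hcS.le
  · have h : ∑ k, w k * (if j ∈ symmDiff (A k) B then (1 : ℝ) else 0) = 1 - S j := by
      rw [hS, eq_sub_iff_add_eq, ← Finset.sum_add_distrib]
      refine (Finset.sum_congr rfl fun k _ => ?_).trans hw1
      by_cases hA : j ∈ A k <;> simp [Finset.mem_symmDiff, hB, hA]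
    rw [h]
    linarith [min_le_right c (1 - c)]

/-- Remark after Theorem 2: for any threshold `c ∈ (0,1)`, under weakly consistent
weighting, `|A_c ∇ A*| / r* → 0` in probability, where `A_c = {j : S_j > c}`. -/
theorem soil_thm2_symmdiff_thresholded_model
    (p K r : ℕ → ℕ) (hp : ∀ n, 0 < p n) (hK : ∀ n, 0 < K n) (hr : ∀ n, 0 < r n)
    (Ω : ℕ → Type*) [∀ n, MeasurableSpace (Ω n)]
    (μ : ∀ n, Measure (Ω n)) [∀ n, IsProbabilityMeasure (μ n)]
    (Astar : ∀ n, Finset (Fin (p n))) (hAcard : ∀ n, (Astar n).card = r n)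
    (A : ∀ n, Fin (K n) → Ω n → Finset (Fin (p n)))
    (w : ∀ n, Fin (K n) → Ω n → ℝ)
    (hw0 : ∀ n k ω, 0 ≤ w n k ω)
    (hw1 : ∀ n ω, ∑ k, w n k ω = 1)
    (S : ∀ n, Fin (p n) → Ω n → ℝ)
    (hS : ∀ n j ω, S n j ω = ∑ k, w n k ω * (if j ∈ A n k ω then (1 : ℝ) else 0))
    (c : ℝ) (hc : c ∈ Set.Ioo (0 : ℝ) 1)
    (hweak : ∀ ε > (0 : ℝ), Tendsto
      (fun n => μ n {ω | ε ≤
        |(∑ k, w n k ω * ((symmDiff (A n k ω) (Astar n)).card : ℝ)) / (r n : ℝ)|})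
      atTop (nhds 0)) :
    ∀ ε > (0 : ℝ), Tendsto
      (fun n => μ n {ω | ε ≤
        |((symmDiff (Finset.univ.filter (fun j => c < S n j ω)) (Astar n)).card : ℝ) /
          (r n : ℝ)|})
      atTop (nhds 0) := by
  intro ε hε
  have hm : 0 < min c (1 - c) := lt_min hc.1 (sub_pos.2 hc.2)
  refine tendsto_of_tendsto_of_tendsto_of_le_of_le tendsto_const_nhds
    (hweak _ (mul_pos hm hε)) (fun n => zero_le) fun n => measure_mono fun ω hω => ?_
  have hr0 : (0 : ℝ) < r n := Nat.cast_pos.2 (hr n)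
  rw [Set.mem_ofPred_eq, abs_of_nonneg (by positivity), le_div_iff₀ hr0] at hω
  rw [Set.mem_ofPred_eq]
  refine le_trans ?_ (le_abs_self _)
  rw [le_div_iff₀ hr0, mul_assoc]
  exact (mul_le_mul_of_nonneg_left hω hm.le).trans
    (min_mul_card_symmDiff_filter_le (fun k => w n k ω) (fun k => hw0 n k ω) (hw1 n ω)
      (fun k => A n k ω) (Astar n) (fun j => S n j ω) (fun j => hS n j ω) c)
end
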